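/- arXiv:1406.1589 — 2 statements merged into one kernel-verified Lean document; each statement's English description precedes it below -/
import Mathlib

section
/- For every m >= 1, the number of involutions of {0,1,...,m-1} all of whose transpositions (c,d) satisfy c+d ∈ J, having exactly k transpositions, is odd if k = 0 and even if k >= 1. -/
/-- `P = {k : k ≡ 0 or 3 (mod 4)}`. -/
def Pset : Set ℕ := {k | k % 4 = 0 ∨ k % 4 = 3}

/-- `Q = {k : k ≡ 1 or 2 (mod 4)}`. -/
def Qset : Set ℕ := {k | k % 4 = 1 ∨ k % 4 = 2}

/-- `J = {(2n+1)·4^j − 1 : n, j ≥ 0}`. -/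
def Jset : Set ℕ := {m | ∃ n j : ℕ, (2 * n + 1) * 4 ^ j - 1 = m}

/-- `J* = {(2n+1)·4^j − 1 : n ≥ 0, j ≥ 1}`. -/
def Jstar : Set ℕ := {m | ∃ n j : ℕ, 1 ≤ j ∧ (2 * n + 1) * 4 ^ j - 1 = m}

/-- `L = ℕ \ J*`. -/
def Lset : Set ℕ := Jstarᶜ

/-- `A|_m`: the finite set of the `m` smallest elements of `A`. -/
noncomputable def smallest (A : Set ℕ) (m : ℕ) : Finset ℕ :=
  (Finset.range m).image (Nat.nth (· ∈ A))

/-- The map `β`: `β l = 2l` if `l` even, `2l + 1` if `l` odd. -/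
def beta (l : ℕ) : ℕ := if Even l then 2 * l else 2 * l + 1

/-- `μ(A, k, B)`: the number of involutions of the finite set `A` (permutations of `ℕ`
fixing everything outside `A` and equal to their own inverse) having exactly `k`
transpositions, all of whose transpositions `(c, d)` satisfy `c + d ∈ B`. -/
noncomputable def mu (A : Finset ℕ) (k : ℕ) (B : Set ℕ) : ℕ :=
  Nat.card {σ : Equiv.Perm ℕ // σ * σ = 1 ∧ (∀ x, σ x ≠ x → x ∈ A) ∧
    (A.filter fun x => σ x ≠ x).card = 2 * k ∧ ∀ c, σ c ≠ c → c + σ c ∈ B}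

open Polynomial Matrix

theorem mem_Jset_iff (n : ℕ) : n ∈ Jset ↔ Even (padicValNat 2 (n + 1)) := by
  have val (a e : ℕ) : padicValNat 2 (2 ^ e * (2 * a + 1)) = e := by
    rw [padicValNat.mul (by positivity) (by omega), padicValNat.prime_pow,
      padicValNat.eq_zero_of_not_dvd (by omega), add_zero]
  constructor
  · rintro ⟨a, j, h⟩
    have hpos : 0 < (2 * a + 1) * 4 ^ j := by positivity
    have h' : n + 1 = 2 ^ (2 * j) * (2 * a + 1) := by
      rw [pow_mul, mul_comm]
      norm_num
      omega
    rw [h', val]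
    exact even_two_mul j
  · intro h
    obtain ⟨e, b, ⟨a, rfl⟩, he⟩ := Nat.exists_eq_two_pow_mul_odd (n := n + 1) (by omega)
    rw [he, val] at h
    obtain ⟨j, rfl⟩ := h
    refine ⟨a, j, ?_⟩
    rw [← two_mul, pow_mul] at he
    norm_num at he
    rw [mul_comm, ← he]
    rfl

theorem two_mul_mem_Jset (n : ℕ) : 2 * n ∈ Jset :=
  ⟨n, 0, by simp⟩

theorem two_mul_add_one_mem_Jset (n : ℕ) : 2 * n + 1 ∈ Jset ↔ n ∉ Jset := by
  rw [mem_Jset_iff, mem_Jset_iff, show 2 * n + 1 + 1 = 2 * (n + 1) by ring,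
    padicValNat.mul (by norm_num) (by omega), padicValNat.self (by norm_num), Nat.even_add]
  simp

open Classical in
/-- The matrix `I + X • A` over `𝔽₂[X]`, where `A` is the adjacency matrix of the graph on `ℕ` in
which distinct `i` and `j` are adjacent when `i + j ∈ B`. -/
noncomputable def sumWeight (B : Set ℕ) (i j : ℕ) : (ZMod 2)[X] :=
  if i = j then 1 else if i + j ∈ B then X else 0

theorem sumWeight_comm (B : Set ℕ) (i j : ℕ) : sumWeight B i j = sumWeight B j i := by
  by_cases h : i = j
  · rw [h]
  · rw [sumWeight, sumWeight, if_neg h, if_neg (Ne.symm h), add_comm]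

theorem Matrix.det_fromBlocks_swap_of_charTwo {R ι : Type*} [CommRing R] [CharP R 2] [Fintype ι]
    [DecidableEq ι] (P Q : Matrix ι ι R) :
    (fromBlocks P Q Q P).det = (P + Q).det ^ 2 := by
  have h : fromBlocks 1 1 0 1 * fromBlocks P Q Q P * fromBlocks 1 1 0 1 =
      fromBlocks (P + Q) 0 Q (P + Q) := by
    simp only [fromBlocks_multiply]
    congr 1 <;> ext i j <;> simp [add_comm, CharTwo.add_self_eq_zero]
  have := congrArg det h
  simpa [det_mul, det_fromBlocks_zero₂₁, det_fromBlocks_zero₁₂, sq] using this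

theorem Matrix.det_fromBlocks_replicateCol {R ι : Type*} [CommRing R] [Fintype ι]
    [DecidableEq ι] (P : Matrix ι ι R) (b u : ι → R) (d : R)
    (hP : P.det = 1) (hu : P *ᵥ u = b) :
    (fromBlocks P (replicateCol Unit b) (replicateRow Unit b) (of fun _ _ => d)).det =
      d - b ⬝ᵥ u := by
  have := invertibleOfIsUnitDet P (by simp [hP])
  rw [det_fromBlocks₁₁, hP, one_mul, det_unique, ← hu, Matrix.mul_assoc,
    replicateCol_mulVec, Matrix.invOf_mul_cancel_left]
  simp [Matrix.mul_apply, dotProduct]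

theorem dotProduct_mulVec_self_of_charTwo {R ι : Type*} [CommRing R] [CharP R 2] [Fintype ι]
    (Q : Matrix ι ι R) (hQ : Qᵀ = Q)
    (hd : ∀ i, Q i i = 0) (w : ι → R) : w ⬝ᵥ Q *ᵥ w = 0 := by
  simp only [dotProduct, mulVec, Finset.mul_sum]
  rw [← Finset.sum_product']
  refine Finset.sum_involution (fun p _ => (p.2, p.1)) ?_ ?_ ?_ ?_
  · rintro ⟨i, j⟩ -
    have : Q j i = Q i j := by rw [← transpose_apply Q, hQ]
    simp only [this]
    rw [show w j * (Q i j * w i) = w i * (Q i j * w j) by ring, CharTwo.add_self_eq_zero]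
  · rintro ⟨i, j⟩ - h1 h2
    simp only [Prod.mk.injEq] at h2
    obtain ⟨rfl, -⟩ := h2
    simp [hd] at h1
  · simp
  · simp

theorem Matrix.det_bordered_swap_of_charTwo {R ι : Type*} [CommRing R] [CharP R 2] [Fintype ι]
    [DecidableEq ι] (P Q : Matrix ι ι R) (x y : ι → R)
    (hP : Pᵀ = P) (hQ : Qᵀ = Q) (hd : ∀ i, Q i i = 0) (hdet : (P + Q).det = 1)
    (hborder : (fromBlocks (P + Q) (replicateCol Unit (x + y)) (replicateRow Unit (x + y))
      (of fun _ _ => 1)).det = 1) :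
    (fromBlocks (fromBlocks P Q Q P) (replicateCol Unit (Sum.elim x y))
      (replicateRow Unit (Sum.elim x y)) (of fun _ _ => 1)).det = 1 := by
  set Z := P + Q with hZ
  have hZt : Zᵀ = Z := by rw [hZ, transpose_add, hP, hQ]
  have hZi : Z * Z⁻¹ = 1 := mul_nonsing_inv Z (by simp [hdet])
  have inv_solve (v : ι → R) : Z *ᵥ (Z⁻¹ *ᵥ v) = v := by rw [mulVec_mulVec, hZi, one_mulVec]
  have self_adj (u v : ι → R) : (Z *ᵥ u) ⬝ᵥ v = u ⬝ᵥ (Z *ᵥ v) := by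
    rw [dotProduct_mulVec, ← mulVec_transpose, hZt]
  set w := Z⁻¹ *ᵥ (x + y) with hw
  have hZw : Z *ᵥ w = x + y := inv_solve _
  rw [det_fromBlocks_replicateCol Z (x + y) w 1 hdet hZw] at hborder
  have hzw : (x + y) ⬝ᵥ w = 0 := by linear_combination -hborder
  set p := Z⁻¹ *ᵥ (x + Q *ᵥ w) with hp
  have hZp : Z *ᵥ p = x + Q *ᵥ w := inv_solve _
  have two (v : ι → R) : v + v = 0 := by ext; exact CharTwo.add_self_eq_zero _
  have hPp : P *ᵥ p + Q *ᵥ p = x + Q *ᵥ w := by rw [← add_mulVec, ← hZ, hZp]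
  have hPw : P *ᵥ w + Q *ᵥ w = x + y := by rw [← add_mulVec, ← hZ, hZw]
  rw [det_fromBlocks_replicateCol _ (Sum.elim x y) (Sum.elim p (p + w)) 1
    (by rw [det_fromBlocks_swap_of_charTwo, ← hZ, hdet, one_pow])]
  · rw [sumElim_dotProduct_sumElim, dotProduct_add, ← add_assoc, ← add_dotProduct, ← hZw, self_adj,
      hZp, dotProduct_add, dotProduct_mulVec_self_of_charTwo Q hQ hd, add_zero,
      dotProduct_comm w x, ← add_dotProduct, hzw, sub_zero]
  · rw [fromBlocks_mulVec]
    simp only [Sum.elim_comp_inl, Sum.elim_comp_inr, mulVec_add]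
    congr 1
    · rw [← add_assoc, hPp, add_assoc, two, add_zero]
    · have : Q *ᵥ p + (P *ᵥ p + P *ᵥ w) = (P *ᵥ p + Q *ᵥ p) + P *ᵥ w := by abel
      rw [this, hPp, add_assoc, add_comm (Q *ᵥ w), hPw, ← add_assoc, two, zero_add]

theorem sumWeight_Jset_odd_odd (a b : ℕ) :
    sumWeight Jset (2 * a + 1) (2 * b + 1) = sumWeight Jset (2 * a) (2 * b) := by
  have h1 : 2 * a + 1 + (2 * b + 1) ∈ Jset := by
    convert two_mul_mem_Jset (a + b + 1) using 1; ring
  have h2 : 2 * a + 2 * b ∈ Jset := by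
    convert two_mul_mem_Jset (a + b) using 1; ring
  simp [sumWeight, h1, h2]

theorem sumWeight_Jset_odd_even (a b : ℕ) :
    sumWeight Jset (2 * a + 1) (2 * b) = sumWeight Jset (2 * a) (2 * b + 1) := by
  have h : 2 * a + 1 + 2 * b = 2 * a + (2 * b + 1) := by ring
  have h1 : 2 * a + 1 ≠ 2 * b := by omega
  have h2 : 2 * a ≠ 2 * b + 1 := by omega
  rw [sumWeight, sumWeight, if_neg h1, if_neg h2, h]

theorem sumWeight_Jset_even_self_succ (a : ℕ) : sumWeight Jset (2 * a) (2 * a + 1) = 0 := by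
  have h : 2 * a + (2 * a + 1) ∉ Jset := by
    rw [show 2 * a + (2 * a + 1) = 2 * (2 * a) + 1 by ring, two_mul_add_one_mem_Jset, not_not]
    exact two_mul_mem_Jset a
  simp [sumWeight, h]

theorem sumWeight_Jset_add (a b : ℕ) :
    sumWeight Jset (2 * a) (2 * b) + sumWeight Jset (2 * a) (2 * b + 1) = sumWeight Jset a b := by
  by_cases hab : a = b
  · subst hab
    rw [sumWeight_Jset_even_self_succ]
    simp [sumWeight]
  · have h1 : 2 * a + 2 * b ∈ Jset := by
      convert two_mul_mem_Jset (a + b) using 1; ring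
    have h2 : 2 * a + (2 * b + 1) ∈ Jset ↔ a + b ∉ Jset := by
      rw [← two_mul_add_one_mem_Jset]; ring_nf
    have h3 : 2 * a ≠ 2 * b + 1 := by omega
    by_cases hJ : a + b ∈ Jset <;>
      simp [sumWeight, hab, h1, h2, h3, hJ, CharTwo.add_self_eq_zero]

theorem det_sumWeight_Jset (m : ℕ) :
    (of fun i j : Fin m => sumWeight Jset i j).det = 1 := by
  induction m using Nat.strong_induction_on with
  | _ m ih =>
  obtain ⟨n, rfl | rfl⟩ := Nat.even_or_odd' m
  · rcases Nat.eq_zero_or_pos n with rfl | hn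
    · simp
    let f : Fin n ⊕ Fin n → Fin (2 * n) :=
      Sum.elim (fun a => ⟨2 * a, by omega⟩) (fun a => ⟨2 * a + 1, by omega⟩)
    have hf : Function.Bijective f := by
      rw [Fintype.bijective_iff_injective_and_card]
      refine ⟨?_, by simp [two_mul]⟩
      rintro (a | a) (b | b) h <;> simp [f, Fin.ext_iff] at h ⊢ <;> omega
    rw [← det_submatrix_equiv_self (Equiv.ofBijective f hf)]
    have h : (of fun i j : Fin (2 * n) => sumWeight Jset i j).submatrix (Equiv.ofBijective f hf)
        (Equiv.ofBijective f hf) =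
        fromBlocks (of fun a b : Fin n => sumWeight Jset (2 * a) (2 * b))
          (of fun a b : Fin n => sumWeight Jset (2 * a) (2 * b + 1))
          (of fun a b : Fin n => sumWeight Jset (2 * a) (2 * b + 1))
          (of fun a b : Fin n => sumWeight Jset (2 * a) (2 * b)) := by
      ext (a | a) (b | b) : 2 <;>
        simp [f, sumWeight_Jset_odd_odd, sumWeight_Jset_odd_even]
    rw [h, det_fromBlocks_swap_of_charTwo]
    convert one_pow (M := (ZMod 2)[X]) 2
    rw [← ih n (by omega)]
    congr 1
    ext a b : 2
    simp [sumWeight_Jset_add]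
  · rcases Nat.eq_zero_or_pos n with rfl | hn
    · simp [sumWeight]
    let f : (Fin n ⊕ Fin n) ⊕ Unit → Fin (2 * n + 1) :=
      Sum.elim (Sum.elim (fun a => ⟨2 * a, by omega⟩) (fun a => ⟨2 * a + 1, by omega⟩))
        (fun _ => ⟨2 * n, by omega⟩)
    have hf : Function.Bijective f := by
      rw [Fintype.bijective_iff_injective_and_card]
      refine ⟨?_, by simp [two_mul]⟩
      rintro ((a | a) | a) ((b | b) | b) h <;> simp [f, Fin.ext_iff] at h ⊢ <;> omega
    let g : Fin n ⊕ Unit → Fin (n + 1) := Sum.elim (fun a => ⟨a, by omega⟩) (fun _ => ⟨n, by omega⟩)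
    have hg : Function.Bijective g := by
      rw [Fintype.bijective_iff_injective_and_card]
      refine ⟨?_, by simp⟩
      rintro (a | a) (b | b) h <;> simp [g, Fin.ext_iff] at h ⊢ <;> omega
    have hsum : (of fun a b : Fin n => sumWeight Jset (2 * a) (2 * b)) +
        (of fun a b : Fin n => sumWeight Jset (2 * a) (2 * b + 1)) =
        of fun a b : Fin n => sumWeight Jset a b := by
      ext a b : 2
      simp [sumWeight_Jset_add]
    have hsucc (a b : ℕ) : sumWeight Jset (2 * a) (2 * b + 1) =
        sumWeight Jset (2 * b) (2 * a + 1) := by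
      rw [sumWeight_comm, sumWeight_Jset_odd_even]
    have key := det_bordered_swap_of_charTwo
      (of fun a b : Fin n => sumWeight Jset (2 * a) (2 * b))
      (of fun a b : Fin n => sumWeight Jset (2 * a) (2 * b + 1))
      (fun a : Fin n => sumWeight Jset (2 * a) (2 * n))
      (fun a : Fin n => sumWeight Jset (2 * a) (2 * n + 1))
      (by ext a b : 2; simp [sumWeight_comm Jset (2 * a)])
      (by ext a b : 2; simp [hsucc a])
      (fun i => sumWeight_Jset_even_self_succ i)
      (by rw [hsum, ih n (by omega)])
      (by
        refine Eq.trans ?_ (ih (n + 1) (by omega))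
        rw [hsum, ← det_submatrix_equiv_self (Equiv.ofBijective g hg)]
        congr 1
        ext (a | a) (b | b) : 2
        · simp [g]
        · simp [g, sumWeight_Jset_add]
        · simp [g, sumWeight_Jset_add, sumWeight_comm Jset n]
        · simp [g, sumWeight])
    rw [← key, ← det_submatrix_equiv_self (Equiv.ofBijective f hf)]
    congr 1
    ext ((a | a) | a) ((b | b) | b) : 2 <;>
      simp [f, sumWeight_Jset_odd_odd, sumWeight_Jset_odd_even]
    · rw [sumWeight_comm]
    · rw [hsucc]
    · simp [sumWeight]

theorem Matrix.det_eq_sum_involutive_of_charTwo {R ι : Type*} [CommRing R] [CharP R 2] [Fintype ι]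
    [DecidableEq ι] (P : Matrix ι ι R) (hP : Pᵀ = P) :
    P.det = ∑ σ : Equiv.Perm ι with σ * σ = 1, ∏ i, P i (σ i) := by
  have hsign (σ : Equiv.Perm ι) : ((Equiv.Perm.sign σ : ℤ) : R) = 1 := by
    rcases Int.units_eq_one_or (Equiv.Perm.sign σ) with h | h <;> simp [h, CharTwo.neg_eq]
  have hsymm (i j : ι) : P i j = P j i := by rw [← transpose_apply P, hP]
  rw [det_apply']
  simp only [hsign, one_mul]
  rw [← Finset.sum_filter_add_sum_filter_not Finset.univ (fun σ : Equiv.Perm ι => σ * σ = 1)]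
  have hzero : ∑ σ : Equiv.Perm ι with ¬σ * σ = 1, ∏ i, P (σ i) i = 0 := by
    refine Finset.sum_involution (fun σ _ => σ⁻¹) ?_ ?_ ?_ ?_
    · intro σ _
      have : ∏ i, P (σ⁻¹ i) i = ∏ i, P (σ i) i := by
        rw [← Equiv.prod_comp σ]
        simp [hsymm]
      rw [this, CharTwo.add_self_eq_zero]
    · intro σ hσ _ h
      simp only [Finset.mem_filter, Finset.mem_univ, true_and] at hσ
      exact hσ (by nth_rewrite 1 [← h]; simp)
    · intro σ hσ
      simp only [Finset.mem_filter, Finset.mem_univ, true_and] at hσ ⊢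
      rwa [← _root_.mul_inv_rev, inv_eq_one]
    · simp
  rw [hzero, add_zero]
  simp [hsymm]

open Classical in
theorem prod_sumWeight_eq (A : Finset ℕ) (B : Set ℕ) (σ : Equiv.Perm A) :
    ∏ i : A, sumWeight B i (σ i) =
      if ∀ i, σ i ≠ i → (i : ℕ) + σ i ∈ B then X ^ σ.support.card else 0 := by
  split_ifs with h
  · rw [← Finset.prod_subset (Finset.subset_univ σ.support), Finset.prod_congr rfl,
      Finset.prod_const]
    · intro i hi
      rw [Equiv.Perm.mem_support] at hi
      have : (i : ℕ) ≠ σ i := fun e => hi (Subtype.ext e.symm)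
      simp [sumWeight, this, h i hi]
    · intro i _ hi
      rw [Equiv.Perm.notMem_support] at hi
      simp [sumWeight, hi]
  · push Not at h
    obtain ⟨i, hi, hB⟩ := h
    refine Finset.prod_eq_zero (Finset.mem_univ i) ?_
    have : (i : ℕ) ≠ σ i := fun e => hi (Subtype.ext e.symm)
    simp [sumWeight, this, hB]

theorem mu_eq_card_perm_subtype (A : Finset ℕ) (k : ℕ) (B : Set ℕ) :
    mu A k B = Nat.card {σ : Equiv.Perm A // σ * σ = 1 ∧ σ.support.card = 2 * k ∧
      ∀ i, σ i ≠ i → (i : ℕ) + σ i ∈ B} := by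
  have hcard (τ : Equiv.Perm A) : (A.filter fun x => Equiv.Perm.ofSubtype τ x ≠ x).card =
      τ.support.card := by
    rw [← Finset.card_map (Function.Embedding.subtype _)]
    congr 1
    ext x
    simp only [Finset.mem_filter, Finset.mem_map, Equiv.Perm.mem_support,
      Function.Embedding.subtype_apply]
    constructor
    · rintro ⟨hx, h⟩
      rw [Equiv.Perm.ofSubtype_apply_of_mem τ hx] at h
      exact ⟨⟨x, hx⟩, fun e => h (by rw [e]), rfl⟩
    · rintro ⟨a, ha, rfl⟩
      refine ⟨a.2, ?_⟩
      rw [Equiv.Perm.ofSubtype_apply_coe]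
      exact fun e => ha (Subtype.ext e)
  symm
  refine Nat.card_congr (Equiv.ofBijective (fun τ => ⟨Equiv.Perm.ofSubtype τ.1, ?_⟩) ⟨?_, ?_⟩)
  · obtain ⟨τ, h1, h2, h3⟩ := τ
    refine ⟨by rw [← map_mul, h1, map_one], ?_, by rw [hcard, h2], ?_⟩
    · intro x hx
      by_contra hxA
      exact hx (Equiv.Perm.ofSubtype_apply_of_not_mem τ hxA)
    · intro c hc
      by_cases hcA : c ∈ A
      · rw [Equiv.Perm.ofSubtype_apply_of_mem τ hcA] at hc ⊢
        exact h3 ⟨c, hcA⟩ fun e => hc (by rw [e])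
      · exact absurd (Equiv.Perm.ofSubtype_apply_of_not_mem τ hcA) hc
  · intro τ τ' h
    exact Subtype.ext (Equiv.Perm.ofSubtype_injective (Subtype.ext_iff.1 h))
  · rintro ⟨σ, h1, h2, h3, h4⟩
    have hmem (x : ℕ) : σ x ∈ A ↔ x ∈ A := by
      by_cases hx : σ x = x
      · rw [hx]
      · exact ⟨fun _ => h2 x hx, fun _ => h2 _ fun e => hx (σ.injective e)⟩
    have hof : Equiv.Perm.ofSubtype (σ.subtypePerm hmem) = σ :=
      Equiv.Perm.ofSubtype_subtypePerm hmem h2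
    refine ⟨⟨σ.subtypePerm hmem, ?_, ?_, ?_⟩, Subtype.ext hof⟩
    · apply Equiv.Perm.ofSubtype_injective
      rw [map_mul, hof, h1, map_one]
    · rw [← hcard, hof, h3]
    · intro i hi
      exact h4 i fun e => hi (Subtype.ext e)

theorem mu_eq_coeff_det (A : Finset ℕ) (k : ℕ) (B : Set ℕ) :
    (mu A k B : ZMod 2) = (of fun i j : A => sumWeight B i j).det.coeff (2 * k) := by
  classical
  rw [det_eq_sum_involutive_of_charTwo _ (by ext i j : 2; simp [sumWeight_comm B i]),
    finsetSum_coeff, mu_eq_card_perm_subtype, Nat.card_eq_fintype_card, Fintype.card_subtype]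
  simp only [of_apply, prod_sumWeight_eq]
  rw [Finset.natCast_card_filter, Finset.sum_filter]
  refine Finset.sum_congr rfl fun σ _ => ?_
  split_ifs <;> simp_all [coeff_X_pow, eq_comm (a := 2 * k)]

theorem stmt_14 (m k : ℕ) (hm : 1 ≤ m) :
    mu (Finset.range m) k Jset ≡ (if k = 0 then 1 else 0) [MOD 2] := by
  rw [← ZMod.natCast_eq_natCast_iff, mu_eq_coeff_det]
  let e : Fin m ≃ Finset.range m :=
    Fin.equivSubtype.trans (Equiv.subtypeEquivRight fun _ => Finset.mem_range.symm)
  rw [← det_submatrix_equiv_self e]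
  have h : (of fun i j : Finset.range m => sumWeight Jset i j).submatrix e e =
      of fun i j : Fin m => sumWeight Jset i j := rfl
  rw [h, det_sumWeight_Jset, coeff_one]
  simp
end

section
/- Let d be the period-doubling sequence and for k >= 1 let H_k(d,t) be the determinant of the k×k matrix whose (i,j) entry is d_{i+j}*t if i=j and d_{i+j} otherwise (indices 0 <= i,j <= k-1). Then H_k(d,t), as a polynomial in t with integer coefficients, is congruent to t^k modulo 2; i.e., the coefficient of t^k is odd and all other coefficients are even. -/
/-- The Thue–Morse sequence: `e k = (-1)^(binary digit sum of k)`. -/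
def thueMorse (k : ℕ) : ℤ := (-1) ^ ((Nat.digits 2 k).sum)

/-- The period-doubling sequence `d k = |e k - e (k+1)| / 2`. -/
def periodDoubling (k : ℕ) : ℕ := (thueMorse k - thueMorse (k + 1)).natAbs / 2

open Polynomial in
/-- The `t`-Hankel matrix of the period-doubling sequence, over `ℤ[t]`:
entry `(i,j)` is `d_{i+j} * t` if `i = j` and `d_{i+j}` otherwise. -/
noncomputable def tHankelPD (k : ℕ) : Matrix (Fin k) (Fin k) (Polynomial ℤ) :=
  Matrix.of fun i j =>
    if i = j then C (periodDoubling ((i : ℕ) + (j : ℕ)) : ℤ) * X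
    else C (periodDoubling ((i : ℕ) + (j : ℕ)) : ℤ)

theorem thueMorse_two_mul (n : ℕ) : thueMorse (2 * n) = thueMorse n := by
  rcases Nat.eq_zero_or_pos n with rfl | h
  · rfl
  · simp [thueMorse, Nat.digits_def' (b := 2) one_lt_two (Nat.mul_pos two_pos h)]

theorem thueMorse_two_mul_add_one (n : ℕ) : thueMorse (2 * n + 1) = -thueMorse n := by
  have h : (2 * n + 1) / 2 = n := by omega
  simp [thueMorse, h, pow_add, Nat.add_mod]

theorem thueMorse_eq_or (n : ℕ) : thueMorse n = 1 ∨ thueMorse n = -1 :=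
  neg_one_pow_eq_or ℤ _

theorem periodDoubling_two_mul (n : ℕ) : periodDoubling (2 * n) = 1 := by
  rw [periodDoubling, thueMorse_two_mul, thueMorse_two_mul_add_one]
  rcases thueMorse_eq_or n with h | h <;> simp [h]

theorem periodDoubling_two_mul_add_one (n : ℕ) :
    periodDoubling (2 * n + 1) + periodDoubling n = 1 := by
  have h2 : 2 * n + 1 + 1 = 2 * (n + 1) := by ring
  rw [periodDoubling, periodDoubling, h2, thueMorse_two_mul, thueMorse_two_mul_add_one]
  rcases thueMorse_eq_or n with h | h <;> rcases thueMorse_eq_or (n + 1) with h' | h' <;>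
    simp [h, h']

open Matrix

section CharTwo

variable {K : Type*} [Field K]

/-- The entries of the `t`-Hankel matrix of the period-doubling sequence, with the diagonal
entries simplified to `t`. -/
def pdEntry (t : K) (i j : ℕ) : K := if i = j then t else (periodDoubling (i + j) : K)

/-- The principal submatrix of `pdEntry t` on the indices listed by `g`. -/
def pdMatrix {ι : Type*} (t : K) (g : ι → ℕ) : Matrix ι ι K :=
  Matrix.of fun a b => pdEntry t (g a) (g b)

theorem pdEntry_comm (t : K) (i j : ℕ) : pdEntry t i j = pdEntry t j i := by
  simp only [pdEntry, eq_comm (a := i), add_comm i]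

theorem pdMatrix_isSymm {ι : Type*} (t : K) (g : ι → ℕ) : (pdMatrix t g).IsSymm := by
  ext a b
  exact pdEntry_comm t _ _

/-- The determinant of a principal submatrix does not depend on how the indices are listed. -/
theorem det_pdMatrix {ι : Type*} [Fintype ι] [DecidableEq ι] (t : K) {k : ℕ} {g : ι → ℕ}
    (hg : Function.Injective g) (hlt : ∀ a, g a < k) (hcard : Fintype.card ι = k) :
    (pdMatrix t g).det = (pdMatrix t (Fin.val : Fin k → ℕ)).det := by
  have hb : Function.Bijective fun a => (⟨g a, hlt a⟩ : Fin k) :=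
    (Fintype.bijective_iff_injective_and_card _).2
      ⟨fun a b h => hg (congrArg Fin.val h), by simpa using hcard⟩
  exact det_submatrix_equiv_self (Equiv.ofBijective _ hb) (pdMatrix t (Fin.val : Fin k → ℕ))

theorem det_bordered {n : Type*} [Fintype n] [DecidableEq n] {A : Matrix n n K}
    (hA : A.det ≠ 0) {b z : n → K} (hz : A *ᵥ z = b) (t : K) :
    (fromBlocks A (replicateCol Unit b) (replicateRow Unit b) (of fun _ _ => t)).det =
      A.det * (t - b ⬝ᵥ z) := by
  have hu : IsUnit A.det := hA.isUnit
  let := invertibleOfIsUnitDet A hu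
  have hzb : A⁻¹ *ᵥ b = z := by
    rw [← hz, mulVec_mulVec, nonsing_inv_mul _ hu, one_mulVec]
  rw [det_fromBlocks₁₁, invOf_eq_nonsing_inv, Matrix.mul_assoc, ← replicateCol_mulVec, hzb]
  simp [det_unique, Matrix.mul_apply, dotProduct]

theorem det_fromBlocks_swap {n : Type*} [Fintype n] [DecidableEq n] [CharP K 2]
    (P Q : Matrix n n K) : (fromBlocks P Q Q P).det = (P + Q).det ^ 2 := by
  have h : fromBlocks 1 1 0 1 * fromBlocks P Q Q P * fromBlocks 1 1 0 1 =
      fromBlocks (P + Q) 0 Q (P + Q) := by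
    simp only [fromBlocks_multiply, Matrix.one_mul, Matrix.mul_one, Matrix.zero_mul,
      Matrix.mul_zero, zero_add, add_zero]
    congr 1
    · ext i j
      simp only [Matrix.add_apply, Matrix.zero_apply]
      linear_combination (P i j + Q i j) * CharTwo.two_eq_zero (R := K)
    · exact add_comm _ _
  have := congrArg det h
  simpa [det_mul, det_fromBlocks_zero₂₁, det_fromBlocks_zero₁₂, sq] using this

/-- In characteristic two only the diagonal of a symmetric matrix contributes to its quadratic
form. -/
theorem dotProduct_mulVec_of_isSymm {n : Type*} [Fintype n] [DecidableEq n] [CharP K 2]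
    {A : Matrix n n K} (hA : A.IsSymm) (y : n → K) :
    y ⬝ᵥ A *ᵥ y = ∑ i, A i i * y i ^ 2 := by
  have hoff : ∑ p ∈ (Finset.univ : Finset (n × n)) with p.1 ≠ p.2,
      y p.1 * (A p.1 p.2 * y p.2) = 0 := by
    refine Finset.sum_involution (fun p _ => p.swap) ?_ ?_ ?_ ?_
    · rintro ⟨i, j⟩ -
      simp only [Prod.swap, hA.apply i j]
      linear_combination (y i * A i j * y j) * CharTwo.two_eq_zero (R := K)
    · rintro ⟨i, j⟩ h - h'
      simp_all
    · rintro ⟨i, j⟩ h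
      simpa [eq_comm] using h
    · simp
  have hdiag : ∑ p ∈ (Finset.univ : Finset (n × n)) with p.1 = p.2, y p.1 * (A p.1 p.2 * y p.2) =
      ∑ i, A i i * y i ^ 2 := by
    rw [Finset.sum_filter, Fintype.sum_prod_type]
    refine Finset.sum_congr rfl fun i _ => ?_
    simp only [Finset.sum_ite_eq, Finset.mem_univ, if_true]
    ring
  have hsplit := Finset.sum_filter_add_sum_filter_not (Finset.univ : Finset (n × n))
    (fun p => p.1 = p.2) fun p => y p.1 * (A p.1 p.2 * y p.2)
  rw [hdiag, hoff, add_zero, Fintype.sum_prod_type] at hsplit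
  simpa [dotProduct, mulVec, Finset.mul_sum] using hsplit.symm

theorem periodDoubling_cast_two_mul_add_one (n : ℕ) :
    (periodDoubling (2 * n + 1) : K) = 1 - periodDoubling n := by
  rw [eq_sub_iff_add_eq]
  exact_mod_cast congrArg (Nat.cast (R := K)) (periodDoubling_two_mul_add_one n)

theorem pdEntry_even_even (t : K) (i j : ℕ) :
    pdEntry t (2 * i) (2 * j) = if i = j then t else 1 := by
  simp [pdEntry, ← mul_add, periodDoubling_two_mul]

theorem pdEntry_odd_odd (t : K) (i j : ℕ) :
    pdEntry t (2 * i + 1) (2 * j + 1) = pdEntry t (2 * i) (2 * j) := by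
  have h : 2 * i + 1 + (2 * j + 1) = 2 * (i + j + 1) := by ring
  simp [pdEntry, h, ← mul_add, periodDoubling_two_mul]

theorem pdEntry_even_odd (t : K) (i j : ℕ) :
    pdEntry t (2 * i) (2 * j + 1) = 1 - periodDoubling (i + j) := by
  have h : 2 * i + (2 * j + 1) = 2 * (i + j) + 1 := by ring
  have hne : 2 * i ≠ 2 * j + 1 := by omega
  rw [pdEntry, if_neg hne, h, periodDoubling_cast_two_mul_add_one]

theorem pdEntry_odd_even (t : K) (i j : ℕ) :
    pdEntry t (2 * i + 1) (2 * j) = pdEntry t (2 * i) (2 * j + 1) := by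
  rw [pdEntry_comm, pdEntry_even_odd, pdEntry_even_odd, add_comm]

theorem pdEntry_add_pdEntry [CharP K 2] (t : K) (i j : ℕ) :
    pdEntry t (2 * i) (2 * j) + pdEntry t (2 * i) (2 * j + 1) = pdEntry t i j := by
  rw [pdEntry_even_even, pdEntry_even_odd, pdEntry]
  split_ifs with h
  · simp [h, ← two_mul, periodDoubling_two_mul]
  · linear_combination (1 - (periodDoubling (i + j) : K)) * CharTwo.two_eq_zero (R := K)

/-- The even-even block of `pdMatrix`. -/
def pdEven (t : K) (m : ℕ) : Matrix (Fin m) (Fin m) K := of fun i j => pdEntry t (2 * i) (2 * j)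

/-- The even-odd block of `pdMatrix`. -/
def pdMixed (t : K) (m : ℕ) : Matrix (Fin m) (Fin m) K :=
  of fun i j => pdEntry t (2 * i) (2 * j + 1)

/-- Lists the even numbers below `2 * m`, then the odd ones. -/
def parityIndex (m : ℕ) : Fin m ⊕ Fin m → ℕ := Sum.elim (fun i => 2 * i) (fun i => 2 * i + 1)

theorem parityIndex_injective (m : ℕ) : Function.Injective (parityIndex m) := by
  rintro (i | i) (j | j) h <;> simp [parityIndex] at h ⊢ <;> omega

theorem parityIndex_lt {m : ℕ} (a : Fin m ⊕ Fin m) : parityIndex m a < 2 * m := by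
  rcases a with i | i <;> simp [parityIndex]
  omega

theorem injective_sum_elim_const {ι : Type*} {g : ι → ℕ} {k : ℕ} (hg : Function.Injective g)
    (hlt : ∀ a, g a < k) : Function.Injective (Sum.elim g fun _ : Unit => k) :=
  hg.sumElim (Function.injective_of_subsingleton _) fun a _ => (hlt a).ne

theorem pdMatrix_sum_elim_const {ι : Type*} (t : K) (g : ι → ℕ) (k : ℕ) :
    pdMatrix t (Sum.elim g fun _ : Unit => k) =
      fromBlocks (pdMatrix t g) (replicateCol Unit fun a => pdEntry t (g a) k)
        (replicateRow Unit fun a => pdEntry t (g a) k) (of fun _ _ => t) := by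
  ext (a | a) (b | b) <;> simp [pdMatrix, pdEntry_comm t k]
  simp [pdEntry]

theorem pdMatrix_parityIndex (t : K) (m : ℕ) : pdMatrix t (parityIndex m) =
    fromBlocks (pdEven t m) (pdMixed t m) (pdMixed t m) (pdEven t m) := by
  ext (a | a) (b | b) <;>
    simp [pdMatrix, parityIndex, pdEven, pdMixed, pdEntry_odd_odd, pdEntry_odd_even]

theorem pdEven_add_pdMixed [CharP K 2] (t : K) (m : ℕ) :
    pdEven t m + pdMixed t m = pdMatrix t (Fin.val : Fin m → ℕ) := by
  ext i j
  exact pdEntry_add_pdEntry t _ _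

theorem det_pdMatrix_two_mul [CharP K 2] (t : K) (m : ℕ) :
    (pdMatrix t (Fin.val : Fin (2 * m) → ℕ)).det =
      (pdMatrix t (Fin.val : Fin m → ℕ)).det ^ 2 := by
  rw [← det_pdMatrix t (parityIndex_injective m) parityIndex_lt (by simp [two_mul]),
    pdMatrix_parityIndex, det_fromBlocks_swap, pdEven_add_pdMixed]

theorem det_pdMatrix_two_mul_add_one [CharP K 2] {t : K} (ht : t ≠ 0) {m : ℕ}
    (hm : (pdMatrix t (Fin.val : Fin m → ℕ)).det = t ^ m)
    (hm' : (pdMatrix t (Fin.val : Fin (m + 1) → ℕ)).det = t ^ (m + 1)) :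
    (pdMatrix t (Fin.val : Fin (2 * m + 1) → ℕ)).det = t ^ (2 * m + 1) := by
  set S := pdMatrix t (Fin.val : Fin m → ℕ)
  set P := pdEven t m
  set Q := pdMixed t m
  have hPQ : P + Q = S := pdEven_add_pdMixed t m
  have hSdet : S.det ≠ 0 := by rw [hm]; exact pow_ne_zero _ ht
  have hsolve (b : Fin m → K) : S *ᵥ (S⁻¹ *ᵥ b) = b := by
    rw [mulVec_mulVec, mul_nonsing_inv _ hSdet.isUnit, one_mulVec]
  have hneg (b : Fin m → K) : -b = b := funext fun i => CharTwo.neg_eq (b i)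
  have hSS : S.IsSymm := pdMatrix_isSymm t _
  have hPS : P.IsSymm := pdMatrix_isSymm t fun i : Fin m => 2 * (i : ℕ)
  set u : Fin m → K := fun i => pdEntry t (2 * i) (2 * m) with hu
  set v : Fin m → K := fun i => pdEntry t (2 * i + 1) (2 * m) with hv
  set w : Fin m → K := fun i => pdEntry t i m with hw
  have huv : u + v = w := by
    ext i
    simp only [hu, hv, hw, Pi.add_apply, pdEntry_odd_even, pdEntry_add_pdEntry]
  set y := S⁻¹ *ᵥ w
  have hSy : S *ᵥ y = w := hsolve w
  have hwy : w ⬝ᵥ y = 0 := by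
    have hinj : Function.Injective (Fin.val : Fin m → ℕ) := Fin.val_injective
    rw [← det_pdMatrix t (injective_sum_elim_const hinj Fin.is_lt)
      (by rintro (a | a) <;> simp) (by simp), pdMatrix_sum_elim_const,
      det_bordered hSdet hSy, hm, pow_succ] at hm'
    simpa using mul_left_cancel₀ (pow_ne_zero _ ht) hm'
  have hyPy : y ⬝ᵥ P *ᵥ y = 0 := by
    have hdiag : y ⬝ᵥ P *ᵥ y = y ⬝ᵥ S *ᵥ y := by
      rw [dotProduct_mulVec_of_isSymm hPS, dotProduct_mulVec_of_isSymm hSS]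
      simp [P, S, pdEven, pdMatrix, pdEntry]
    rw [hdiag, hSy, dotProduct_comm, hwy]
  set z := S⁻¹ *ᵥ (u + Q *ᵥ y)
  have hSz : S *ᵥ z = u + Q *ᵥ y := hsolve _
  have hAz : fromBlocks P Q Q P *ᵥ Sum.elim z (z + y) = Sum.elim u v := by
    have h1 : P *ᵥ z + Q *ᵥ (z + y) = u := by
      rw [mulVec_add, ← add_assoc, ← add_mulVec, hPQ, hSz, add_assoc]
      nth_rw 2 [← hneg (Q *ᵥ y)]
      simp
    have h2 : Q *ᵥ z + P *ᵥ (z + y) = v := by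
      have h : (P *ᵥ z + Q *ᵥ (z + y)) + (Q *ᵥ z + P *ᵥ (z + y)) = w := by
        calc _ = (P + Q) *ᵥ z + ((P + Q) *ᵥ z + (P + Q) *ᵥ y) := by
              simp only [add_mulVec, mulVec_add]; abel
          _ = w := by
              rw [hPQ, hSy]
              nth_rw 2 [← hneg (S *ᵥ z)]
              simp
      rw [h1, ← huv] at h
      exact add_left_cancel h
    rw [fromBlocks_mulVec]
    simp [h1, h2]
  have hval : Sum.elim u v ⬝ᵥ Sum.elim z (z + y) = 0 := by
    rw [sumElim_dotProduct_sumElim, dotProduct_add, ← add_assoc, ← add_dotProduct, huv]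
    have h1 : w ⬝ᵥ z = y ⬝ᵥ u + y ⬝ᵥ Q *ᵥ y := by
      rw [← dotProduct_add, ← hSz, dotProduct_mulVec y, ← mulVec_transpose, hSS.eq, hSy]
    have h2 : y ⬝ᵥ Q *ᵥ y = 0 := by
      have := congrArg (fun A => y ⬝ᵥ A *ᵥ y) hPQ
      simpa [add_mulVec, hyPy, hSy, dotProduct_comm y w, hwy] using this
    rw [h1, h2, add_zero, dotProduct_comm v, ← dotProduct_add, huv, dotProduct_comm, hwy]
  have hA : (fromBlocks P Q Q P).det = t ^ (2 * m) := by
    rw [det_fromBlocks_swap, hPQ, hm, ← pow_mul, mul_comm]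
  have hb : (fun a => pdEntry t (parityIndex m a) (2 * m)) = Sum.elim u v := by
    ext (a | a) <;> rfl
  rw [← det_pdMatrix t (injective_sum_elim_const (parityIndex_injective m) parityIndex_lt)
    (by rintro (a | a); exacts [(parityIndex_lt a).trans (Nat.lt_succ_self _), Nat.lt_succ_self _])
    (by simp [two_mul]), pdMatrix_sum_elim_const, hb, pdMatrix_parityIndex,
    det_bordered (by rw [hA]; exact pow_ne_zero _ ht) hAz, hval, hA, sub_zero, pow_succ]

theorem det_pdMatrix_eq_pow [CharP K 2] {t : K} (ht : t ≠ 0) (k : ℕ) :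
    (pdMatrix t (Fin.val : Fin k → ℕ)).det = t ^ k := by
  induction k using Nat.strong_induction_on with
  | _ k ih =>
    obtain ⟨m, rfl | rfl⟩ := Nat.even_or_odd' k
    · rcases Nat.eq_zero_or_pos m with rfl | hm
      · simp
      · rw [det_pdMatrix_two_mul, ih m (by omega), ← pow_mul, mul_comm]
    · rcases Nat.eq_zero_or_pos m with rfl | hm
      · simp [pdMatrix, pdEntry, det_unique]
      · exact det_pdMatrix_two_mul_add_one ht (ih m (by omega)) (ih (m + 1) (by omega))

end CharTwo

open Polynomial in
theorem stmt_15 (k : ℕ) (hk : 1 ≤ k) :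
    (tHankelPD k).det.map (Int.castRingHom (ZMod 2)) = X ^ k := by
  let K := FractionRing (ZMod 2)[X]
  have hinj : Function.Injective (algebraMap (ZMod 2)[X] K) := IsFractionRing.injective _ _
  have : CharP K 2 := charP_of_injective_algebraMap hinj 2
  apply hinj
  have hX : algebraMap (ZMod 2)[X] K X ≠ 0 := fun h =>
    X_ne_zero (hinj (h.trans (map_zero _).symm))
  rw [map_pow, ← det_pdMatrix_eq_pow hX, ← coe_mapRingHom, RingHom.map_det, RingHom.map_det]
  congr 1
  ext i j
  by_cases h : i = j
  · subst h
    simp [tHankelPD, pdMatrix, pdEntry, ← two_mul, periodDoubling_two_mul]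
  · simp [tHankelPD, pdMatrix, pdEntry, h, Fin.val_inj]
end
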